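/- There exists an integer l⋆(ε) such that S_l ≥ ((1−2ε)³/3 · (l − l⋆(ε)) + S_{l⋆(ε)}^{(1−2ε)/3})^{3/(1−2ε)} for all integers l ≥ l⋆(ε). -/

import Mathlib

noncomputable section

namespace CubePacking

/-- The side lengths `ℓ_k := k^{−(1+ε)/3}`. -/
def sideLen (ε : ℝ) (k : ℕ) : ℝ := (k : ℝ) ^ (-(1 + ε) / 3)

/-- `L_n^m := ∑_{k=n}^m ℓ_k`, the length needed to put the cubes `n,…,m` in a row. -/
def L (ε : ℝ) (n m : ℕ) : ℝ := ∑ k ∈ Finset.Icc n m, sideLen ε k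

/-- `M_n := max{m ≥ n : L_n^m ≤ 1} − n + 1`, the number of cubes, starting from the `n`-th,
fitting in a row of length `1`.  (The maximum exists for `n ≥ 1` since `ℓ_n ≤ 1` and
`L_n^m → ∞` as `m → ∞`; it is realized here by `sSup`, which coincides with the maximum
of a nonempty bounded-above set of naturals.) -/
def M (ε : ℝ) (n : ℕ) : ℕ := sSup {m : ℕ | n ≤ m ∧ L ε n m ≤ 1} - n + 1

/-- The index `B^n_r` of the first cube of the `r`-th row when rows are started at the `n`-th
cube: `B^n_1 := n` and `B^n_{r+1} := B^n_r + M_{B^n_r}` for `r ≥ 1`. -/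
def B (ε : ℝ) (n : ℕ) : ℕ → ℕ
  | 0 => n
  | 1 => n
  | r + 2 => B ε n (r + 1) + M ε (B ε n (r + 1))

/-- `W_n^R := ∑_{r=1}^R (B^n_r)^{−(1+ε)/3}`, the width occupied by `R` rows starting at the
`n`-th cube. -/
def W (ε : ℝ) (n R : ℕ) : ℝ := ∑ r ∈ Finset.Icc 1 R, (B ε n r : ℝ) ^ (-(1 + ε) / 3)

/-- `R_n := max{R ≥ 1 : W_n^R ≤ 1}`, the number of rows fitting in the unit square starting
from the `n`-th cube.  (Again the maximum is realized by `sSup`.) -/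
def Rn (ε : ℝ) (n : ℕ) : ℕ := sSup {R : ℕ | 1 ≤ R ∧ W ε n R ≤ 1}

/-- `N_n := B^n_{R_n+1} − n + 1`, the number of cubes in those rows. -/
def N (ε : ℝ) (n : ℕ) : ℕ := B ε n (Rn ε n + 1) - n + 1

/-- The index `S_l` of the cube starting the `l`-th vertical layer:
`S_1 := 1` and `S_{l+1} := S_l + N_{S_l}` for `l ≥ 1`. -/
def S (ε : ℝ) : ℕ → ℕ
  | 0 => 1
  | 1 => 1
  | l + 2 => S ε (l + 1) + N ε (S ε (l + 1))

/-- The height `H_l := S_l^{−(1+ε)/3}` of the `l`-th layer. -/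
def H (ε : ℝ) (l : ℕ) : ℝ := (S ε l : ℝ) ^ (-(1 + ε) / 3)

end CubePacking

namespace CubePacking

open Filter Topology

lemma L_eq_sum {ε : ℝ} (n m : ℕ) :
    L ε n m = ∑ k ∈ Finset.Icc n m, ((k : ℝ) ^ ((1 + ε) / 3))⁻¹ := by
  refine Finset.sum_congr rfl fun k _ => ?_
  rw [sideLen, neg_div, Real.rpow_neg (Nat.cast_nonneg k)]

lemma W_succ {ε : ℝ} (n R : ℕ) :
    W ε n (R + 1) = W ε n R + ((B ε n (R + 1) : ℝ) ^ ((1 + ε) / 3))⁻¹ := by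
  rw [W, Finset.sum_Icc_succ_top (by omega), ← W, neg_div, Real.rpow_neg (Nat.cast_nonneg _)]

lemma rpow_le_sqrt {ε x : ℝ} (hε : ε < 1 / 2) (hx : 1 ≤ x) : x ^ ((1 + ε) / 3) ≤ √x := by
  rw [Real.sqrt_eq_rpow]
  exact Real.rpow_le_rpow_of_exponent_le hx (by linarith)

/-- A row sum is at least the number of its terms times the smallest one. -/
lemma card_mul_le_L {ε : ℝ} (hε0 : 0 < ε) {n m : ℕ} (hn : 1 ≤ n) (hnm : n ≤ m) :
    ((m : ℝ) + 1 - n) * ((m : ℝ) ^ ((1 + ε) / 3))⁻¹ ≤ L ε n m := by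
  rw [L_eq_sum]
  have h := Finset.card_nsmul_le_sum (Finset.Icc n m)
    (fun k : ℕ => ((k : ℝ) ^ ((1 + ε) / 3))⁻¹) (((m : ℝ) ^ ((1 + ε) / 3))⁻¹) (by
      intro k hk
      rw [Finset.mem_Icc] at hk
      have hk0 : (0 : ℝ) < k := by exact_mod_cast (by omega : 0 < k)
      have hkm : (k : ℝ) ≤ m := by exact_mod_cast hk.2
      gcongr)
  rwa [nsmul_eq_mul, Nat.card_Icc, Nat.cast_sub (by omega), Nat.cast_add, Nat.cast_one] at h

lemma L_le_card_mul {ε : ℝ} (hε0 : 0 < ε) {n m : ℕ} (hn : 1 ≤ n) (hnm : n ≤ m) :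
    L ε n m ≤ ((m : ℝ) + 1 - n) * ((n : ℝ) ^ ((1 + ε) / 3))⁻¹ := by
  rw [L_eq_sum]
  have h := Finset.sum_le_card_nsmul (Finset.Icc n m)
    (fun k : ℕ => ((k : ℝ) ^ ((1 + ε) / 3))⁻¹) (((n : ℝ) ^ ((1 + ε) / 3))⁻¹) (by
      intro k hk
      rw [Finset.mem_Icc] at hk
      have hn0 : (0 : ℝ) < n := by exact_mod_cast hn
      have hkm : (n : ℝ) ≤ k := by exact_mod_cast hk.1
      gcongr)
  rwa [nsmul_eq_mul, Nat.card_Icc, Nat.cast_sub (by omega), Nat.cast_add, Nat.cast_one] at h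

lemma card_le_rpow {ε : ℝ} (hε0 : 0 < ε) {n m : ℕ} (hn : 1 ≤ n) (hnm : n ≤ m)
    (h : L ε n m ≤ 1) : (m : ℝ) + 1 - n ≤ (m : ℝ) ^ ((1 + ε) / 3) := by
  have hm0 : (0 : ℝ) < m := by exact_mod_cast (by omega : 0 < m)
  have h1 := (card_mul_le_L hε0 hn hnm).trans h
  rwa [← div_eq_mul_inv, div_le_one (Real.rpow_pos_of_pos hm0 _)] at h1

lemma le_two_mul_of_L_le_one {ε : ℝ} (hε0 : 0 < ε) (hε : ε < 1 / 2) {n m : ℕ} (hn : 1 ≤ n)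
    (hnm : n ≤ m) (h : L ε n m ≤ 1) : m ≤ 2 * n := by
  have hm1 : (1 : ℝ) ≤ m := by exact_mod_cast hn.trans hnm
  have h1 := (card_le_rpow hε0 hn hnm h).trans (rpow_le_sqrt hε hm1)
  have h2 : (m : ℝ) ≤ 2 * n := by
    nlinarith [sq_nonneg (√(m : ℝ) - 1), Real.sq_sqrt (zero_le_one.trans hm1)]
  exact_mod_cast h2

lemma bddAbove_row {ε : ℝ} (hε0 : 0 < ε) (hε : ε < 1 / 2) {n : ℕ} (hn : 1 ≤ n) :
    BddAbove {m : ℕ | n ≤ m ∧ L ε n m ≤ 1} :=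
  ⟨2 * n, fun _ hm => le_two_mul_of_L_le_one hε0 hε hn hm.1 hm.2⟩

lemma floor_mem_row {ε : ℝ} (hε0 : 0 < ε) {n : ℕ} (hn : 1 ≤ n) :
    n + ⌊(n : ℝ) ^ ((1 + ε) / 3)⌋₊ - 1 ∈ {m : ℕ | n ≤ m ∧ L ε n m ≤ 1} := by
  have hn1 : (1 : ℝ) ≤ n := by exact_mod_cast hn
  have h1 : (1 : ℝ) ≤ (n : ℝ) ^ ((1 + ε) / 3) := Real.one_le_rpow hn1 (by linarith)
  have hf : 1 ≤ ⌊(n : ℝ) ^ ((1 + ε) / 3)⌋₊ := Nat.le_floor (by simpa using h1)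
  have hle : n ≤ n + ⌊(n : ℝ) ^ ((1 + ε) / 3)⌋₊ - 1 := by omega
  refine ⟨hle, (L_le_card_mul hε0 hn hle).trans ?_⟩
  rw [← div_eq_mul_inv, div_le_one (by positivity), Nat.cast_sub (by omega)]
  push_cast
  linarith [Nat.floor_le (zero_le_one.trans h1)]

lemma floor_le_M {ε : ℝ} (hε0 : 0 < ε) (hε : ε < 1 / 2) {n : ℕ} (hn : 1 ≤ n) :
    ⌊(n : ℝ) ^ ((1 + ε) / 3)⌋₊ ≤ M ε n := by
  have h := le_csSup (bddAbove_row hε0 hε hn) (floor_mem_row hε0 hn)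
  rw [M]
  omega

lemma M_le {ε : ℝ} (hε0 : 0 < ε) (hε : ε < 1 / 2) {n : ℕ} (hn : 1 ≤ n) :
    (M ε n : ℝ) ≤ 2 * √(n : ℝ) := by
  have hmem := Nat.sSup_mem ⟨_, floor_mem_row hε0 hn⟩ (bddAbove_row hε0 hε hn)
  rw [M]
  set m := sSup {m : ℕ | n ≤ m ∧ L ε n m ≤ 1}
  obtain ⟨hnm, hL⟩ := hmem
  have hm1 : (1 : ℝ) ≤ m := by exact_mod_cast hn.trans hnm
  have h2 : (m : ℝ) ≤ 2 ^ 2 * n := by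
    exact_mod_cast (le_two_mul_of_L_le_one hε0 hε hn hnm hL).trans (by omega)
  have h3 := (card_le_rpow hε0 hn hnm hL).trans (rpow_le_sqrt hε hm1)
  have h4 := Real.sqrt_le_sqrt h2
  rw [Real.sqrt_mul (by positivity), Real.sqrt_sq (by norm_num)] at h4
  push_cast [Nat.cast_sub hnm]
  linarith

lemma le_B {ε : ℝ} (n r : ℕ) : n ≤ B ε n (r + 1) := by
  induction r with
  | zero => simp [B]
  | succ r ih => exact ih.trans (Nat.le_add_right _ _)

lemma B_le {ε : ℝ} (hε0 : 0 < ε) (hε : ε < 1 / 2) {n : ℕ} (hn : 1 ≤ n) (r : ℕ) :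
    (B ε n (r + 1) : ℝ) ≤ ((n : ℝ) + r) ^ 2 := by
  have hn1 : (1 : ℝ) ≤ n := by exact_mod_cast hn
  induction r with
  | zero => simp only [B, Nat.cast_zero, add_zero]; nlinarith
  | succ r ih =>
    have hM := M_le hε0 hε (hn.trans (le_B (ε := ε) n r))
    have hs : √(B ε n (r + 1) : ℝ) ≤ n + r := Real.sqrt_le_iff.2 ⟨by positivity, ih⟩
    rw [B]
    push_cast
    nlinarith

lemma sum_le_W {ε : ℝ} (hε0 : 0 < ε) (hε : ε < 1 / 2) {n : ℕ} (hn : 1 ≤ n) (R : ℕ) :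
    ∑ i ∈ Finset.range R, 1 / ((n : ℝ) + i) ≤ W ε n R := by
  have hn1 : (1 : ℝ) ≤ n := by exact_mod_cast hn
  induction R with
  | zero => simp [W]
  | succ R ih =>
    rw [Finset.sum_range_succ, W_succ, one_div]
    have hB : (1 : ℝ) ≤ B ε n (R + 1) := by exact_mod_cast hn.trans (le_B n R)
    have h1 := (rpow_le_sqrt hε hB).trans
      (Real.sqrt_le_iff.2 ⟨by positivity, B_le hε0 hε hn R⟩)
    gcongr

lemma bddAbove_rows {ε : ℝ} (hε0 : 0 < ε) (hε : ε < 1 / 2) {n : ℕ} (hn : 1 ≤ n) :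
    BddAbove {R : ℕ | 1 ≤ R ∧ W ε n R ≤ 1} := by
  have hn1 : (1 : ℝ) ≤ n := by exact_mod_cast hn
  obtain ⟨K, hK⟩ :=
    (tendsto_atTop.1 Real.tendsto_sum_range_one_div_nat_succ_atTop (n + 1 : ℝ)).exists_forall_of_atTop
  refine ⟨K, fun R hR => ?_⟩
  by_contra! hlt
  have h1 := hK R hlt.le
  have h2 : ∑ i ∈ Finset.range R, 1 / ((i : ℝ) + 1)
      ≤ n * ∑ i ∈ Finset.range R, 1 / ((n : ℝ) + i) := by
    rw [Finset.mul_sum]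
    refine Finset.sum_le_sum fun i _ => ?_
    rw [mul_one_div, div_le_div_iff₀ (by positivity) (by positivity)]
    nlinarith [(Nat.cast_nonneg i : (0 : ℝ) ≤ i)]
  nlinarith [(sum_le_W hε0 hε hn R).trans hR.2]

lemma one_lt_W {ε : ℝ} (hε0 : 0 < ε) (hε : ε < 1 / 2) {n : ℕ} (hn : 1 ≤ n) :
    1 < W ε n (Rn ε n + 1) := by
  by_contra! h
  have := le_csSup (bddAbove_rows hε0 hε hn)
    (show Rn ε n + 1 ∈ {R : ℕ | 1 ≤ R ∧ W ε n R ≤ 1} from ⟨by omega, h⟩)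
  rw [← Rn] at this
  omega

/-- Appending to `x` an initial segment of length about `x ^ a` increases `x ^ (1 - 2 * a)` by
almost `(1 - 2 * a) * x ^ (-a)`. -/
lemma eventually_rpow_add_floor {a q : ℝ} (ha0 : 0 < a) (ha : a < 1 / 2) (hq0 : 0 < q)
    (hq : q < 1) :
    ∀ᶠ x : ℝ in atTop, (1 - 2 * a) * q ^ 2 * (x ^ a)⁻¹
      ≤ (x + ⌊x ^ a⌋₊) ^ (1 - 2 * a) - x ^ (1 - 2 * a) := by
  have hσ : 0 < 1 - 2 * a := by linarith
  have hd : HasDerivAt (fun y : ℝ => (1 + y) ^ (1 - 2 * a)) (1 - 2 * a) 0 := by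
    have h := ((hasDerivAt_id (0 : ℝ)).const_add 1).rpow_const (p := 1 - 2 * a) (by simp)
    simpa using h
  have hev : ∀ᶠ y : ℝ in 𝓝[≥] 0, (1 - 2 * a) * q * y ≤ (1 + y) ^ (1 - 2 * a) - 1 := by
    have hlt : (1 - 2 * a) * q < 1 - 2 * a := by nlinarith
    have h1 := (hasDerivAt_iff_tendsto_slope_zero.1 hd).eventually (lt_mem_nhds hlt)
    rw [eventually_nhdsWithin_iff] at h1 ⊢
    filter_upwards [h1] with y hy hy0
    rcases (Set.mem_Ici.1 hy0).eq_or_lt with rfl | hpos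
    · simp
    · have := hy hpos.ne'
      simp only [zero_add, add_zero, Real.one_rpow, smul_eq_mul] at this
      rw [inv_mul_eq_div, lt_div_iff₀ hpos] at this
      exact this.le
  have hx : Tendsto (fun x : ℝ => (⌊x ^ a⌋₊ : ℝ) / x) atTop (𝓝[≥] 0) := by
    refine tendsto_nhdsWithin_iff.2 ⟨?_, ?_⟩
    · refine squeeze_zero' ?_ ?_ (tendsto_rpow_neg_atTop (by linarith : 0 < 1 - a))
      · filter_upwards [eventually_gt_atTop 0] with x hx
        positivity
      · filter_upwards [eventually_gt_atTop 0] with x hx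
        rw [neg_sub, Real.rpow_sub_one hx.ne']
        gcongr
        exact Nat.floor_le (by positivity)
    · filter_upwards [eventually_gt_atTop 0] with x hx
      exact div_nonneg (Nat.cast_nonneg _) hx.le
  filter_upwards [hx.eventually hev, eventually_gt_atTop 0,
    (tendsto_rpow_atTop ha0).eventually_ge_atTop (1 / (1 - q))] with x h hx0 hlarge
  set m : ℝ := (⌊x ^ a⌋₊ : ℝ)
  have hm0 : 0 ≤ m := Nat.cast_nonneg _
  have hm : q * x ^ a ≤ m := by
    rw [div_le_iff₀ (by linarith)] at hlarge
    have := Nat.lt_floor_add_one (x ^ a)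
    change x ^ a < m + 1 at this
    nlinarith
  have hsplit : x + m = x * (1 + m / x) := by field_simp
  have hpow : (x ^ a)⁻¹ = x ^ (1 - 2 * a) * (x ^ a / x) := by
    rw [← Real.rpow_neg hx0.le, ← Real.rpow_sub_one hx0.ne', ← Real.rpow_add hx0]
    congr 1
    ring
  rw [hsplit, Real.mul_rpow hx0.le (by positivity), hpow]
  calc (1 - 2 * a) * q ^ 2 * (x ^ (1 - 2 * a) * (x ^ a / x))
      = x ^ (1 - 2 * a) * ((1 - 2 * a) * q * ((q * x ^ a) / x)) := by ring
    _ ≤ x ^ (1 - 2 * a) * ((1 - 2 * a) * q * (m / x)) := by gcongr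
    _ ≤ x ^ (1 - 2 * a) * ((1 + m / x) ^ (1 - 2 * a) - 1) := by gcongr
    _ = _ := by ring

lemma mul_W_le {ε c : ℝ} (hε0 : 0 < ε) (hε : ε < 1 / 2) {n : ℕ} (hn : 1 ≤ n)
    (h : ∀ x : ℝ, n ≤ x → c * (x ^ ((1 + ε) / 3))⁻¹
      ≤ (x + ⌊x ^ ((1 + ε) / 3)⌋₊) ^ ((1 - 2 * ε) / 3) - x ^ ((1 - 2 * ε) / 3)) (R : ℕ) :
    c * W ε n R ≤ (B ε n (R + 1) : ℝ) ^ ((1 - 2 * ε) / 3) - (n : ℝ) ^ ((1 - 2 * ε) / 3) := by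
  induction R with
  | zero => simp [W, B]
  | succ R ih =>
    have h1 := h (B ε n (R + 1)) (by exact_mod_cast le_B n R)
    have h2 : ((B ε n (R + 1) : ℝ) + ⌊(B ε n (R + 1) : ℝ) ^ ((1 + ε) / 3)⌋₊)
        ^ ((1 - 2 * ε) / 3) ≤ (B ε n (R + 2) : ℝ) ^ ((1 - 2 * ε) / 3) := by
      refine Real.rpow_le_rpow (by positivity) ?_ (by linarith)
      rw [B]
      exact_mod_cast Nat.add_le_add_left (floor_le_M hε0 hε (hn.trans (le_B n R))) _
    rw [W_succ, mul_add]
    linarith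

lemma eventually_rpow_add_N {ε q : ℝ} (hε0 : 0 < ε) (hε : ε < 1 / 2) (hq0 : 0 < q)
    (hq : q < 1) :
    ∀ᶠ n : ℕ in atTop, (1 - 2 * ε) / 3 * q ^ 3 + (n : ℝ) ^ ((1 - 2 * ε) / 3)
      ≤ ((n + N ε n : ℕ) : ℝ) ^ ((1 - 2 * ε) / 3) := by
  have hstep := eventually_rpow_add_floor (a := (1 + ε) / 3) (by linarith) (by linarith) hq0 hq
  rw [show 1 - 2 * ((1 + ε) / 3) = (1 - 2 * ε) / 3 by ring] at hstep
  obtain ⟨X, hX⟩ := eventually_atTop.1 hstep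
  have hcast := tendsto_natCast_atTop_atTop (R := ℝ)
  filter_upwards [eventually_ge_atTop 1, hcast.eventually_ge_atTop X,
    ((tendsto_rpow_atTop (by linarith : 0 < (1 + ε) / 3)).comp hcast).eventually_ge_atTop
      (1 / (1 - q))] with n hn hnX hlarge
  have hn0 : (0 : ℝ) < n := by exact_mod_cast hn
  have h1 := mul_W_le hε0 hε hn (fun x hx => hX x (hnX.trans hx)) (Rn ε n)
  have hW := one_lt_W hε0 hε hn
  rw [W_succ] at hW
  have hnB : (n : ℝ) ≤ B ε n (Rn ε n + 1) := by exact_mod_cast le_B n (Rn ε n)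
  have hlast : ((B ε n (Rn ε n + 1) : ℝ) ^ ((1 + ε) / 3))⁻¹ ≤ 1 - q := by
    refine inv_le_of_inv_le₀ (by linarith) ?_
    rw [← one_div]
    exact hlarge.trans (Real.rpow_le_rpow hn0.le hnB (by linarith))
  have hc : 0 < (1 - 2 * ε) / 3 * q ^ 2 := by
    have : 0 < 1 - 2 * ε := by linarith
    positivity
  have h2 : (B ε n (Rn ε n + 1) : ℝ) ^ ((1 - 2 * ε) / 3)
      ≤ ((n + N ε n : ℕ) : ℝ) ^ ((1 - 2 * ε) / 3) := by
    refine Real.rpow_le_rpow (by positivity) ?_ (by linarith)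
    rw [N]
    exact_mod_cast (by omega)
  nlinarith

lemma le_S {ε : ℝ} (l : ℕ) : l ≤ S ε l := by
  induction l with
  | zero => simp
  | succ l ih =>
    cases l with
    | zero => simp [S]
    | succ l =>
      rw [S]
      have : 1 ≤ N ε (S ε (l + 1)) := by simp [N]
      omega

end CubePacking

open CubePacking in
/-- Lower bound on `S_l`.
There exists `l⋆(ε)` such that for all `l ≥ l⋆(ε)`,
`S_l ≥ ((1−2ε)³/3 (l − l⋆(ε)) + S_{l⋆(ε)}^{(1−2ε)/3})^{3/(1−2ε)}`. -/
theorem S_lower_bound (ε : ℝ) (hε0 : 0 < ε) (hε : ε < 1 / 2) :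
    ∃ lst : ℕ, ∀ l : ℕ, lst ≤ l →
      ((1 - 2 * ε) ^ 3 / 3 * ((l : ℝ) - (lst : ℝ)) + (S ε lst : ℝ) ^ ((1 - 2 * ε) / 3))
          ^ (3 / (1 - 2 * ε))
        ≤ (S ε l : ℝ) := by
  have hs0 : 0 < 1 - 2 * ε := by linarith
  obtain ⟨q, hq0, hq1, hq⟩ : ∃ q : ℝ, 0 < q ∧ q < 1 ∧ (1 - 2 * ε) ^ 2 ≤ q ^ 3 := by
    refine ⟨1 + ((1 - 2 * ε) ^ 2 - 1) / 3, by nlinarith, by nlinarith, ?_⟩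
    have := one_add_mul_le_pow (a := ((1 - 2 * ε) ^ 2 - 1) / 3) (by nlinarith) 3
    push_cast at this
    linarith
  obtain ⟨K, hK⟩ := Filter.eventually_atTop.1 (eventually_rpow_add_N hε0 hε hq0 hq1)
  refine ⟨K + 1, fun l hl => ?_⟩
  have key : (1 - 2 * ε) ^ 3 / 3 * ((l : ℝ) - ((K + 1 : ℕ) : ℝ))
      + (S ε (K + 1) : ℝ) ^ ((1 - 2 * ε) / 3) ≤ (S ε l : ℝ) ^ ((1 - 2 * ε) / 3) := by
    induction l, hl using Nat.le_induction with
    | base => simp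
    | succ l hl ih =>
      obtain ⟨j, rfl⟩ : ∃ j, l = j + 1 := ⟨l - 1, by omega⟩
      have h := hK (S ε (j + 1)) ((by omega : K ≤ j + 1).trans (le_S _))
      rw [← S] at h
      push_cast at ih ⊢
      nlinarith
  have hl' : ((K + 1 : ℕ) : ℝ) ≤ l := by exact_mod_cast hl
  have hnonneg : 0 ≤ (1 - 2 * ε) ^ 3 / 3 * ((l : ℝ) - ((K + 1 : ℕ) : ℝ))
      + (S ε (K + 1) : ℝ) ^ ((1 - 2 * ε) / 3) :=
    add_nonneg (mul_nonneg (by positivity) (by linarith)) (by positivity)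
  refine (Real.rpow_le_rpow hnonneg key (by positivity)).trans_eq ?_
  rw [← Real.rpow_mul (Nat.cast_nonneg _), div_mul_div_cancel₀ (by norm_num), div_self hs0.ne',
    Real.rpow_one]
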